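/- arXiv:2011.01951 — 2 statements merged into one kernel-verified Lean document; each statement's English description precedes it below -/
import Mathlib

section
/- An operator A on H_N belongs to A_inv (i.e. UAU† = A for all U ∈ U_sym) if and only if for all h, h' ∈ G^{N−1} and all characters χ, χ' ∈ Ĝ with (χ,χ') ≠ (𝟙,𝟙), the matrix element ⟨h;χ|A|h';χ'⟩ vanishes unless (h,χ) = (h',χ'). Equivalently, A ∈ A_inv if and only if A = Π_phys A Π_phys + Σ_{h∈G^{N−1}} Σ_{χ∈Ĝ, χ≠𝟙} a_{h;χ} |h;χ⟩⟨h;χ| for some complex numbers a_{h;χ}. -/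
noncomputable section

open Matrix

namespace QRF

section Defs

variable (G : Type) [Fintype G] [DecidableEq G] [CommGroup G]

/-- The `K`-particle Hilbert space `ℂ^{G^K}` (as functions `G^K → ℂ`). -/
abbrev Vec (K : ℕ) : Type := (Fin K → G) → ℂ

/-- Linear operators on the `K`-particle Hilbert space. -/
abbrev Op (K : ℕ) : Type := Matrix (Fin K → G) (Fin K → G) ℂ

variable {G}

/-- The standard basis vector `|x⟩`. -/
def ket {K : ℕ} (x : Fin K → G) : Vec G K := fun y => if y = x then 1 else 0

/-- The global translation `T_g`, `T_g |x₁,…,x_K⟩ = |g x₁, …, g x_K⟩`. -/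
def trans {K : ℕ} (g : G) : Op G K :=
  Matrix.of fun x y => if x = (fun i => g * y i) then 1 else 0

/-- The configuration `(g, h₁ g, …, h_k g)`, i.e. `|g, hg⟩`. -/
def cfg {k : ℕ} (h : Fin k → G) (g : G) : Fin (k + 1) → G :=
  Fin.cons g fun i => h i * g

/-- The inner product `⟨v, w⟩` (antilinear in the first argument). -/
def inn {K : ℕ} (v w : Vec G K) : ℂ := star v ⬝ᵥ w

/-- The rank-one operator `|v⟩⟨w|`. -/
def outer {K : ℕ} (v w : Vec G K) : Op G K :=
  Matrix.of fun x y => v x * (starRingEnd ℂ) (w y)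

/-- The matrix element `⟨v|A|w⟩`. -/
def melem {K : ℕ} (v : Vec G K) (A : Op G K) (w : Vec G K) : ℂ :=
  star v ⬝ᵥ A.mulVec w

/-- The Hilbert–Schmidt inner product `⟨A,B⟩ := tr(A† B)`. -/
def hsInner {K : ℕ} (A B : Op G K) : ℂ := (Aᴴ * B).trace

variable (G)

/-- The symmetry group `U_sym` of relation-conditional global translations
(for `k+1` particles). -/
def Usym (k : ℕ) : Set (Op G (k + 1)) :=
  {U | U ∈ Matrix.unitaryGroup (Fin (k + 1) → G) ℂ ∧
    ∃ c : (Fin k → G) → G, ∀ (h : Fin k → G) (g : G),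
      U.mulVec (ket (cfg h g)) = (trans (c h)).mulVec (ket (cfg h g))}

/-- The characters of `G`: monoid homomorphisms `G → ℂ` of modulus one. -/
def Ghat : Type := {χ : G →* ℂ // ∀ g : G, ‖χ g‖ = 1}

/-- The trivial character `𝟙`. -/
instance : One (Ghat G) := ⟨⟨1, fun g => by simp⟩⟩

variable {G}

/-- The vector `|h;χ⟩ := |G|^{-1/2} ∑_{g ∈ G} χ(g⁻¹) |g, hg⟩`. -/
def relKet {k : ℕ} (h : Fin k → G) (χ : Ghat G) : Vec G (k + 1) :=
  ((Real.sqrt (Fintype.card G) : ℂ))⁻¹ • ∑ g : G, χ.1 g⁻¹ • ket (cfg h g)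

variable (G)

/-- The relational subspace `H_phys = span{|h;𝟙⟩}`. -/
def Hphys (k : ℕ) : Submodule ℂ (Vec G (k + 1)) :=
  Submodule.span ℂ {v | ∃ h : Fin k → G, v = relKet h (1 : Ghat G)}

/-- `Π_phys = ∑_h |h;𝟙⟩⟨h;𝟙|`, the orthogonal projection onto `H_phys`. -/
def Piphys (k : ℕ) : Op G (k + 1) :=
  ∑ h : Fin k → G, outer (relKet h (1 : Ghat G)) (relKet h (1 : Ghat G))

variable {G}

/-- `Π_{h;χ≠𝟙} = ∑_{χ ∈ Ĝ, χ ≠ 𝟙} |h;χ⟩⟨h;χ|`. -/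
def PiNot1 {k : ℕ} (h : Fin k → G) : Op G (k + 1) :=
  ∑ᶠ (χ : Ghat G) (_ : χ ≠ 1), outer (relKet h χ) (relKet h χ)

variable (G)

/-- The invariant algebra `A_inv`. -/
def Ainv (k : ℕ) : Set (Op G (k + 1)) :=
  {A | ∀ U ∈ Usym G k, U * A * Uᴴ = A}

/-- The incoherent group average (twirl) `Π_inv` over `U_sym`. -/
def Piinv (k : ℕ) (ρ : Op G (k + 1)) : Op G (k + 1) :=
  (Nat.card ↥(Usym G k) : ℂ)⁻¹ • ∑ᶠ U ∈ Usym G k, U * ρ * Uᴴ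

/-- The algebra `A_phys` of relational observables (operators supported on `H_phys`). -/
def Aphys (k : ℕ) : Set (Op G (k + 1)) :=
  {A | A = Piphys G k * A * Piphys G k}

/-- The algebra `A_alg`. -/
def Aalg (k : ℕ) : Set (Op G (k + 1)) :=
  {X | ∃ B ∈ Aphys G k, ∃ a : (Fin k → G) → ℂ,
      X = B + ∑ h : Fin k → G, a h • PiNot1 h}

variable {G}

/-- The vector `|e⟩_i ⊗ φ`. -/
def insVec {k : ℕ} (i : Fin (k + 1)) (φ : (Fin k → G) → ℂ) : Vec G (k + 1) :=
  fun x => if x i = 1 then φ (fun j => x (i.succAbove j)) else 0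

/-- The operator `|e⟩⟨e|_i ⊗ A`. -/
def eAop {k : ℕ} (i : Fin (k + 1)) (A : Matrix (Fin k → G) (Fin k → G) ℂ) :
    Op G (k + 1) :=
  Matrix.of fun x y =>
    if x i = 1 ∧ y i = 1 then
      A (fun j => x (i.succAbove j)) (fun j => y (i.succAbove j))
    else 0

/-- `ψ` is `i`-alignable. -/
def IAlignable {k : ℕ} (i : Fin (k + 1)) (ψ : Vec G (k + 1)) : Prop :=
  ∃ (θ : ℝ) (U : Op G (k + 1)) (φ : (Fin k → G) → ℂ),
    U ∈ Usym G k ∧ ψ = Complex.exp (θ * Complex.I) • U.mulVec (insVec i φ)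

/-- `ψ` is alignable. -/
def Alignable {k : ℕ} (ψ : Vec G (k + 1)) : Prop := ∃ i, IAlignable i ψ

/-- Symmetry equivalence of state vectors (up to a global phase). -/
def SymmEquiv {k : ℕ} (ψ ψ' : Vec G (k + 1)) : Prop :=
  ∃ (θ : ℝ) (U : Op G (k + 1)),
    U ∈ Usym G k ∧ ψ' = Complex.exp (θ * Complex.I) • U.mulVec ψ

/-- `P` is the orthogonal projection of operator space onto the set `S`,
with respect to the Hilbert–Schmidt inner product. -/
def IsHSProj {K : ℕ} (S : Set (Op G K)) (P : Op G K →ₗ[ℂ] Op G K) : Prop :=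
  (∀ ρ, P ρ ∈ S) ∧ (∀ A ∈ S, P A = A) ∧
    ∀ ρ σ, hsInner (P ρ) σ = hsInner ρ (P σ)

/-- First `n+1` components of an `(n+1)+(m+1)`-particle configuration. -/
def split1 {n m : ℕ} (x : Fin (n + m + 1 + 1) → G) : Fin (n + 1) → G :=
  fun i => x ⟨i.1, by have := i.2; omega⟩

/-- Last `m+1` components of an `(n+1)+(m+1)`-particle configuration. -/
def split2 {n m : ℕ} (x : Fin (n + m + 1 + 1) → G) : Fin (m + 1) → G :=
  fun i => x ⟨n + 1 + i.1, by have := i.2; omega⟩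

/-- The tensor product `A ⊗ B` of operators, under the identification
`H_{N+M} ≅ H_N ⊗ H_M`, `|x,y⟩ ↦ |x⟩ ⊗ |y⟩`. -/
def tensorOp {n m : ℕ} (A : Op G (n + 1)) (B : Op G (m + 1)) :
    Op G (n + m + 1 + 1) :=
  Matrix.of fun x y => A (split1 x) (split1 y) * B (split2 x) (split2 y)

/-- Concatenation `(h, g⃗)` of relation tuples. -/
def relcat {n m : ℕ} (h : Fin n → G) (gv : Fin (m + 1) → G) :
    Fin (n + m + 1) → G :=
  (Fin.append h gv : Fin (n + (m + 1)) → G)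

/-- Joining of configurations `(x, z)`. -/
def join {n m : ℕ} (x : Fin (n + 1) → G) (z : Fin (m + 1) → G) :
    Fin (n + m + 1 + 1) → G :=
  fun i => if hi : i.1 < n + 1 then x ⟨i.1, hi⟩
           else z ⟨i.1 - (n + 1), by have := i.2; omega⟩

/-- The standard partial trace over the last `m+1` particles. -/
def ptraceM {n m : ℕ} (ρ : Op G (n + m + 1 + 1)) : Op G (n + 1) :=
  Matrix.of fun x y => ∑ z : Fin (m + 1) → G, ρ (join x z) (join y z)

end Defs

section Characters

variable {G : Type}

lemma Ghat.ext_apply [CommGroup G] {χ χ' : Ghat G} (h : ∀ g, χ.1 g = χ'.1 g) : χ = χ' :=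
  Subtype.ext (MonoidHom.ext h)

@[simp]
lemma Ghat.one_apply [CommGroup G] (g : G) : (1 : Ghat G).1 g = 1 := rfl

lemma Ghat.mul_conj [CommGroup G] (χ : Ghat G) (g : G) : χ.1 g * star (χ.1 g) = 1 := by
  rw [Complex.star_def, Complex.mul_conj', χ.2 g]
  simp

lemma Ghat.conj_apply [CommGroup G] (χ : Ghat G) (g : G) : star (χ.1 g) = χ.1 g⁻¹ := by
  have h : χ.1 g⁻¹ * χ.1 g = 1 := by rw [← map_mul]; simp
  calc star (χ.1 g) = χ.1 g⁻¹ * χ.1 g * star (χ.1 g) := by rw [h, one_mul]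
    _ = χ.1 g⁻¹ := by rw [mul_assoc, χ.mul_conj, mul_one]

variable (G) [Fintype G] [CommGroup G]

/-- Characters of `G` are the additive characters of `Additive G`. -/
def ghatEquiv : AddChar (Additive G) ℂ ≃ Ghat G where
  toFun ψ := ⟨⟨⟨fun g => ψ (Additive.ofMul g), by simp⟩,
    fun a b => by simp [AddChar.map_add_eq_mul]⟩, fun g => ψ.norm_apply _⟩
  invFun χ := ⟨fun a => χ.1 a.toMul, by simp, by simp⟩
  left_inv _ := rfl
  right_inv _ := rfl

instance : Fintype (Ghat G) := Fintype.ofEquiv _ (ghatEquiv G)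

instance : DecidableEq (Ghat G) := Classical.decEq _

lemma Ghat.card_eq : Fintype.card (Ghat G) = Fintype.card G := by
  rw [← Fintype.card_congr (ghatEquiv G), AddChar.card_eq, Fintype.card_congr Additive.toMul]

variable {G}

lemma Ghat.sum_apply_eq_ite [DecidableEq G] (g : G) :
    ∑ χ : Ghat G, χ.1 g = if g = 1 then (Fintype.card G : ℂ) else 0 := by
  rw [← (ghatEquiv G).sum_comp]
  have := AddChar.sum_apply_eq_ite (α := Additive G) (Additive.ofMul g)
  rwa [Fintype.card_congr Additive.toMul] at this

end Characters

section RelationalBasis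

variable {G : Type} {n : ℕ}

/-- Configurations are parametrized by their relations and the position of the first particle. -/
def cfgEquiv [CommGroup G] : (Fin n → G) × G ≃ (Fin (n + 1) → G) where
  toFun p := cfg p.1 p.2
  invFun x := (fun i => x i.succ * (x 0)⁻¹, x 0)
  left_inv p := by simp [cfg]
  right_inv x := by
    funext i
    refine Fin.cases ?_ (fun j => ?_) i <;> simp [cfg]

lemma cfg_inj [CommGroup G] {h h' : Fin n → G} {g g' : G} :
    cfg h g = cfg h' g' ↔ h = h' ∧ g = g' := by
  have := (cfgEquiv (G := G) (n := n)).injective.eq_iff (a := (h, g)) (b := (h', g'))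
  rwa [Prod.mk.injEq] at this

lemma mul_cfg [CommGroup G] (a : G) (h : Fin n → G) (g : G) :
    (fun i => a * cfg h g i) = cfg h (a * g) := by
  funext i
  refine Fin.cases ?_ (fun j => ?_) i
  · simp [cfg]
  · simp [cfg, mul_left_comm]

/-- The eigenvalue `χ(c(h))` at `|h;χ⟩` of the translation conditional on `c`. -/
def phase [CommGroup G] (c : (Fin n → G) → G) (p : (Fin n → G) × Ghat G) : ℂ := p.2.1 (c p.1)

lemma phase_mul_star [CommGroup G] (c : (Fin n → G) → G) (p : (Fin n → G) × Ghat G) :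
    phase c p * star (phase c p) = 1 :=
  p.2.mul_conj _

lemma phase_mul_star_eq_one_iff [DecidableEq G] [CommGroup G] (p q : (Fin n → G) × Ghat G) :
    (∀ c, phase c p * star (phase c q) = 1) ↔ (p.2, q.2) = (1, 1) ∨ p = q := by
  obtain ⟨h, χ⟩ := p
  obtain ⟨h', χ'⟩ := q
  constructor
  · intro H
    simp only [phase] at H
    by_cases hh : h = h'
    · subst hh
      right
      have : χ = χ' := Ghat.ext_apply fun g => by
        calc χ.1 g = χ.1 g * star (χ'.1 g) * χ'.1 g := by
              rw [mul_assoc, mul_comm (star _), χ'.mul_conj, mul_one]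
          _ = χ'.1 g := by rw [H fun _ => g, one_mul]
      rw [this]
    · left
      refine Prod.ext (Ghat.ext_apply fun g => ?_) (Ghat.ext_apply fun g => ?_)
      · simpa [Function.update_of_ne (Ne.symm hh)] using H (Function.update (fun _ => 1) h g)
      · have := H (Function.update (fun _ => 1) h' g)
        rw [Function.update_self, Function.update_of_ne hh, map_one, one_mul] at this
        simpa using congrArg star this
  · rintro (H | H) c
    · obtain ⟨h1, h2⟩ := Prod.mk.inj H
      simp only at h1 h2
      simp [phase, h1, h2]
    · rw [H, phase_mul_star]

variable [Fintype G] [DecidableEq G] [CommGroup G]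

lemma relKet_cfg (h h' : Fin n → G) (χ : Ghat G) (g : G) :
    relKet h χ (cfg h' g) =
      if h' = h then ((Real.sqrt (Fintype.card G) : ℂ))⁻¹ * χ.1 g⁻¹ else 0 := by
  simp only [relKet, ket, Pi.smul_apply, Finset.sum_apply, cfg_inj, smul_eq_mul]
  split_ifs with hh <;> simp [hh]

variable (G n)

/-- The matrix whose columns are the vectors `|h;χ⟩`. -/
def relBasis : Matrix (Fin (n + 1) → G) ((Fin n → G) × Ghat G) ℂ :=
  Matrix.of fun x p => relKet p.1 p.2 x

variable {G n}

/-- The relation-conditional translation determined by `c`, in its spectral form. -/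
def condTrans (c : (Fin n → G) → G) : Op G (n + 1) :=
  relBasis G n * diagonal (phase c) * (relBasis G n)ᴴ

lemma condTrans_cfg (c : (Fin n → G) → G) (h h' : Fin n → G) (g g' : G) :
    condTrans c (cfg h g) (cfg h' g') = if cfg h g = cfg h' (c h' * g') then 1 else 0 := by
  have hcard : (Fintype.card G : ℂ) ≠ 0 := Nat.cast_ne_zero.2 Fintype.card_ne_zero
  have hs : ((Real.sqrt (Fintype.card G) : ℂ))⁻¹ * ((Real.sqrt (Fintype.card G) : ℂ))⁻¹ =
      (Fintype.card G : ℂ)⁻¹ := by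
    rw [← mul_inv, ← Complex.ofReal_mul, Real.mul_self_sqrt (Nat.cast_nonneg _),
      Complex.ofReal_natCast]
  rw [condTrans, Matrix.mul_apply, Fintype.sum_prod_type]
  simp only [Matrix.mul_diagonal, conjTranspose_apply, relBasis, of_apply, relKet_cfg, phase]
  by_cases hh : h = h'
  · subst hh
    rw [Finset.sum_eq_single h (fun b _ hb => by simp [hb.symm]) (by simp)]
    calc _ = ∑ χ : Ghat G, (Fintype.card G : ℂ)⁻¹ * χ.1 (g⁻¹ * (c h * g')) := by
          refine Finset.sum_congr rfl fun χ _ => ?_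
          rw [if_pos rfl, if_pos rfl, star_mul', χ.conj_apply, inv_inv, map_mul, map_mul, ← hs,
            star_inv₀, Complex.star_def, Complex.conj_ofReal]
          ring
      _ = _ := by
          simp only [← Finset.mul_sum, Ghat.sum_apply_eq_ite, cfg_inj, true_and, inv_mul_eq_one]
          split_ifs <;> simp [hcard]
  · rw [if_neg (by simp [cfg_inj, hh])]
    refine Finset.sum_eq_zero fun k _ => Finset.sum_eq_zero fun χ _ => ?_
    by_cases hk : h = k
    · simp [show h' ≠ k from fun e => hh (hk.trans e.symm)]
    · simp [hk]

lemma relBasis_mul_conjTranspose : relBasis G n * (relBasis G n)ᴴ = 1 := by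
  have h1 : relBasis G n * (relBasis G n)ᴴ = condTrans (fun _ : Fin n → G => (1 : G)) := by
    have : phase (fun _ : Fin n → G => (1 : G)) = fun _ => 1 := by
      funext p
      simp [phase]
    rw [condTrans, this, diagonal_one, Matrix.mul_one]
  rw [h1]
  ext x y
  obtain ⟨⟨h, g⟩, rfl⟩ := cfgEquiv.surjective x
  obtain ⟨⟨h', g'⟩, rfl⟩ := cfgEquiv.surjective y
  simp only [cfgEquiv, Equiv.coe_fn_mk, condTrans_cfg, Matrix.one_apply, one_mul]
  congr

lemma conjTranspose_mul_relBasis : (relBasis G n)ᴴ * relBasis G n = 1 := by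
  refine (Matrix.mul_eq_one_comm_of_card_eq _ _ _ ?_).1 relBasis_mul_conjTranspose
  rw [← Fintype.card_congr (cfgEquiv (G := G) (n := n)), Fintype.card_prod, Fintype.card_prod,
    Ghat.card_eq]

lemma condTrans_mem_Usym (c : (Fin n → G) → G) : condTrans c ∈ Usym G n := by
  refine ⟨?_, c, fun h g => ?_⟩
  · have hd : diagonal (phase c) * (diagonal (phase c))ᴴ = 1 := by
      rw [diagonal_conjTranspose, diagonal_mul_diagonal, ← diagonal_one]
      exact congrArg diagonal (funext fun p => phase_mul_star c p)
    rw [Matrix.mem_unitaryGroup_iff, star_eq_conjTranspose, condTrans]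
    simp only [conjTranspose_mul, conjTranspose_conjTranspose]
    calc _ = relBasis G n * (diagonal (phase c) * ((relBasis G n)ᴴ * relBasis G n) *
          (diagonal (phase c))ᴴ) * (relBasis G n)ᴴ := by simp only [Matrix.mul_assoc]
      _ = 1 := by
        rw [conjTranspose_mul_relBasis, Matrix.mul_one, hd, Matrix.mul_one,
          relBasis_mul_conjTranspose]
  · funext x
    obtain ⟨⟨h', g'⟩, rfl⟩ := cfgEquiv.surjective x
    simp [mulVec, dotProduct, ket, trans, mul_cfg, cfgEquiv, condTrans_cfg]

lemma mem_Usym_iff {U : Op G (n + 1)} : U ∈ Usym G n ↔ ∃ c, U = condTrans c := by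
  constructor
  · rintro ⟨-, c, hc⟩
    refine ⟨c, ?_⟩
    ext x y
    obtain ⟨⟨h, g⟩, rfl⟩ := cfgEquiv.surjective x
    obtain ⟨⟨h', g'⟩, rfl⟩ := cfgEquiv.surjective y
    have := congrFun (hc h' g') (cfg h g)
    simpa [mulVec, dotProduct, ket, trans, mul_cfg, cfgEquiv, condTrans_cfg] using this
  · rintro ⟨c, rfl⟩
    exact condTrans_mem_Usym c

/-- The matrix of an operator in the basis `|h;χ⟩`. -/
def relMatrix (A : Op G (n + 1)) : Matrix ((Fin n → G) × Ghat G) ((Fin n → G) × Ghat G) ℂ :=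
  (relBasis G n)ᴴ * A * relBasis G n

lemma relMatrix_apply (A : Op G (n + 1)) (p q : (Fin n → G) × Ghat G) :
    relMatrix A p q = melem (relKet p.1 p.2) A (relKet q.1 q.2) := by
  rw [relMatrix, Matrix.mul_assoc, Matrix.mul_apply]
  rfl

lemma relBasis_mul_relMatrix (A : Op G (n + 1)) :
    relBasis G n * relMatrix A * (relBasis G n)ᴴ = A := by
  calc _ = (relBasis G n * (relBasis G n)ᴴ) * A * (relBasis G n * (relBasis G n)ᴴ) := by
        simp only [relMatrix, Matrix.mul_assoc]
    _ = A := by rw [relBasis_mul_conjTranspose, Matrix.one_mul, Matrix.mul_one]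

lemma relMatrix_conj (M : Matrix ((Fin n → G) × Ghat G) ((Fin n → G) × Ghat G) ℂ) :
    relMatrix (relBasis G n * M * (relBasis G n)ᴴ) = M := by
  calc _ = ((relBasis G n)ᴴ * relBasis G n) * M * ((relBasis G n)ᴴ * relBasis G n) := by
        simp only [relMatrix, Matrix.mul_assoc]
    _ = M := by rw [conjTranspose_mul_relBasis, Matrix.one_mul, Matrix.mul_one]

lemma relMatrix_injective : Function.Injective (relMatrix (G := G) (n := n)) :=
  fun A B h => by rw [← relBasis_mul_relMatrix A, h, relBasis_mul_relMatrix]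

lemma relMatrix_mul (A B : Op G (n + 1)) :
    relMatrix (A * B) = relMatrix A * relMatrix B := by
  calc _ = (relBasis G n)ᴴ * A * (relBasis G n * (relBasis G n)ᴴ) * B * relBasis G n := by
        rw [relBasis_mul_conjTranspose, Matrix.mul_one, relMatrix, Matrix.mul_assoc _ A B]
    _ = _ := by simp only [relMatrix, Matrix.mul_assoc]

lemma relMatrix_add (A B : Op G (n + 1)) :
    relMatrix (A + B) = relMatrix A + relMatrix B := by
  simp only [relMatrix, Matrix.mul_add, Matrix.add_mul]

lemma relMatrix_conjTranspose (A : Op G (n + 1)) : relMatrix Aᴴ = (relMatrix A)ᴴ := by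
  simp only [relMatrix, conjTranspose_mul, conjTranspose_conjTranspose, Matrix.mul_assoc]

lemma relMatrix_sum_outer (d : (Fin n → G) × Ghat G → ℂ) :
    relMatrix (∑ p, d p • outer (relKet p.1 p.2) (relKet p.1 p.2)) = diagonal d := by
  rw [← relMatrix_conj (diagonal d)]
  congr 1
  ext x y
  rw [Matrix.sum_apply, Matrix.mul_apply]
  refine Finset.sum_congr rfl fun p _ => ?_
  simp only [Matrix.smul_apply, outer, relBasis, Matrix.mul_diagonal, conjTranspose_apply,
    of_apply, smul_eq_mul, starRingEnd_apply]
  ring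

lemma relMatrix_Piphys :
    relMatrix (Piphys G n) = diagonal fun p => if p.2 = 1 then 1 else 0 := by
  rw [← relMatrix_sum_outer, Fintype.sum_prod_type]
  congr 1
  refine Finset.sum_congr rfl fun h _ => ?_
  simp

lemma relMatrix_diagonal_part (a : (Fin n → G) → Ghat G → ℂ) :
    relMatrix (∑ h : Fin n → G, ∑ᶠ (χ : Ghat G) (_ : χ ≠ 1),
      a h χ • outer (relKet h χ) (relKet h χ)) =
    diagonal fun p => if p.2 = 1 then 0 else a p.1 p.2 := by
  rw [← relMatrix_sum_outer, Fintype.sum_prod_type]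
  congr 1
  refine Finset.sum_congr rfl fun h _ => ?_
  rw [finsum_eq_sum_of_fintype]
  refine Finset.sum_congr rfl fun χ _ => ?_
  by_cases hχ : χ = 1 <;> simp [hχ]

lemma mem_Ainv_iff_phase {A : Op G (n + 1)} :
    A ∈ Ainv G n ↔ ∀ c p q, phase c p * relMatrix A p q * star (phase c q) = relMatrix A p q := by
  have key : ∀ c : (Fin n → G) → G, condTrans c * A * (condTrans c)ᴴ = A ↔
      ∀ p q, phase c p * relMatrix A p q * star (phase c q) = relMatrix A p q := by
    intro c
    rw [← relMatrix_injective.eq_iff, relMatrix_mul, relMatrix_mul, relMatrix_conjTranspose,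
      condTrans, relMatrix_conj, diagonal_conjTranspose, ← Matrix.ext_iff]
    simp only [Matrix.mul_diagonal, Matrix.diagonal_mul, Pi.star_apply]
  constructor
  · exact fun hA c => (key c).1 (hA _ (condTrans_mem_Usym c))
  · intro h U hU
    obtain ⟨c, rfl⟩ := mem_Usym_iff.1 hU
    exact (key c).2 (h c)

lemma mem_Ainv_iff {A : Op G (n + 1)} :
    A ∈ Ainv G n ↔ ∀ p q : (Fin n → G) × Ghat G,
      (p.2, q.2) ≠ (1, 1) → p ≠ q → relMatrix A p q = 0 := by
  rw [mem_Ainv_iff_phase]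
  constructor
  · intro H p q h1 h2
    by_contra h0
    refine not_or.2 ⟨h1, h2⟩ ((phase_mul_star_eq_one_iff p q).1 fun c => ?_)
    refine mul_right_cancel₀ h0 ?_
    rw [one_mul, mul_right_comm, H]
  · intro H c p q
    by_cases h : (p.2, q.2) = (1, 1) ∨ p = q
    · rw [mul_right_comm, (phase_mul_star_eq_one_iff p q).2 h, one_mul]
    · rw [H p q (fun e => h (.inl e)) (fun e => h (.inr e)), mul_zero, zero_mul]

lemma mem_Ainv_iff_exists {A : Op G (n + 1)} :
    A ∈ Ainv G n ↔ ∃ a : (Fin n → G) → Ghat G → ℂ,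
      A = Piphys G n * A * Piphys G n +
        ∑ h : Fin n → G, ∑ᶠ (χ : Ghat G) (_ : χ ≠ 1),
          a h χ • outer (relKet h χ) (relKet h χ) := by
  have key : ∀ a : (Fin n → G) → Ghat G → ℂ,
      A = Piphys G n * A * Piphys G n +
        ∑ h : Fin n → G, ∑ᶠ (χ : Ghat G) (_ : χ ≠ 1),
          a h χ • outer (relKet h χ) (relKet h χ) ↔
      ∀ p q, relMatrix A p q =
        (if p.2 = 1 then 1 else 0) * relMatrix A p q * (if q.2 = 1 then 1 else 0) +
          diagonal (fun p => if p.2 = 1 then 0 else a p.1 p.2) p q := by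
    intro a
    rw [← relMatrix_injective.eq_iff, relMatrix_add, relMatrix_mul, relMatrix_mul,
      relMatrix_Piphys, relMatrix_diagonal_part, ← Matrix.ext_iff]
    simp only [Matrix.add_apply, Matrix.mul_diagonal, Matrix.diagonal_mul]
  simp only [key, mem_Ainv_iff]
  constructor
  · intro H
    refine ⟨fun h χ => relMatrix A (h, χ) (h, χ), fun p q => ?_⟩
    by_cases hpq : p = q
    · subst hpq
      by_cases hp : p.2 = 1 <;> simp [hp]
    · rw [diagonal_apply_ne _ hpq]
      by_cases hp : p.2 = 1
      · by_cases hq : q.2 = 1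
        · simp [hp, hq]
        · simp [H p q (by simp [hq]) hpq]
      · simp [H p q (by simp [hp]) hpq]
  · rintro ⟨a, H⟩ p q h1 h2
    rw [H p q, diagonal_apply_ne _ h2, add_zero]
    by_cases hp : p.2 = 1
    · have hq : q.2 ≠ 1 := fun hq => h1 (by rw [hp, hq])
      simp [hq]
    · simp [hp]

end RelationalBasis

/-- `A ∈ A_inv` iff all matrix elements `⟨h;χ|A|h';χ'⟩` with
`(χ,χ') ≠ (𝟙,𝟙)` vanish unless `(h,χ) = (h',χ')`; equivalently, iff
`A = Π_phys A Π_phys + ∑_h ∑_{χ≠𝟙} a_{h;χ} |h;χ⟩⟨h;χ|` for some complex `a_{h;χ}`. -/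
theorem stmt2 (G : Type) [Fintype G] [DecidableEq G] [CommGroup G] (n : ℕ)
    (A : Op G (n + 1)) :
    (A ∈ Ainv G n ↔
      ∀ (h h' : Fin n → G) (χ χ' : Ghat G), (χ, χ') ≠ (1, 1) → (h, χ) ≠ (h', χ') →
        melem (relKet h χ) A (relKet h' χ') = 0) ∧
    (A ∈ Ainv G n ↔
      ∃ a : (Fin n → G) → Ghat G → ℂ,
        A = Piphys G n * A * Piphys G n +
          ∑ h : Fin n → G, ∑ᶠ (χ : Ghat G) (_ : χ ≠ 1),
            a h χ • outer (relKet h χ) (relKet h χ)) := by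
  refine ⟨?_, mem_Ainv_iff_exists⟩
  simp only [mem_Ainv_iff, relMatrix_apply]
  exact ⟨fun H h h' χ χ' => H (h, χ) (h', χ'), fun H p q => H p.1 q.1 p.2 q.2⟩

end QRF

end
end

section
/- Fix i ∈ {1,…,N}. The map A ↦ F_A := |G| · Π_phys (|e⟩⟨e|_i ⊗ A) Π_phys, from L(ℂ^{G^{N−1}}) to L(H_N), is a bijection onto A_phys that preserves linear combinations (F_{λA+μB} = λF_A + μF_B), products (F_{AB} = F_A F_B), and adjoints (F_{A†} = (F_A)†); in particular it is a star-algebra isomorphism between L(ℂ^{G^{N−1}}) and A_phys. -/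
noncomputable section

open Matrix

namespace QRF

/-- The map `A ↦ F_A := |G| ⬝ Π_phys (|e⟩⟨e|_i ⊗ A) Π_phys`. -/
def Fmap (G : Type) [Fintype G] [DecidableEq G] [CommGroup G] {n : ℕ}
    (i : Fin (n + 1)) (A : Matrix (Fin n → G) (Fin n → G) ℂ) : Op G (n + 1) :=
  (Fintype.card G : ℂ) • (Piphys G n * eAop i A * Piphys G n)

/-- The normalization `|G|^{-1/2}` of the vectors `|h;χ⟩`. -/
def relNorm (G : Type) [Fintype G] : ℂ := ((Real.sqrt (Fintype.card G) : ℂ))⁻¹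

lemma star_relNorm (G : Type) [Fintype G] : star (relNorm G) = relNorm G := by
  simp [relNorm]

lemma card_mul_relNorm_sq (G : Type) [Fintype G] [Nonempty G] :
    (Fintype.card G : ℂ) * (relNorm G * relNorm G) = 1 := by
  have h : (Real.sqrt (Fintype.card G) : ℂ) * Real.sqrt (Fintype.card G) = Fintype.card G := by
    rw [← Complex.ofReal_mul, Real.mul_self_sqrt (Nat.cast_nonneg _), Complex.ofReal_natCast]
  rw [relNorm, ← mul_inv, h]
  exact mul_inv_cancel₀ (Nat.cast_ne_zero.2 Fintype.card_ne_zero)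

section RelationalIsometry

variable {G : Type} [CommGroup G] {n : ℕ}

/-- The relations `x_j / x_i` of a configuration, as seen from particle `i`. -/
def relTuple (i : Fin (n + 1)) (x : Fin (n + 1) → G) : Fin n → G :=
  fun j => x (i.succAbove j) / x i

lemma relTuple_insertNth_one (i : Fin (n + 1)) (a : Fin n → G) :
    relTuple i (i.insertNth 1 a : Fin (n + 1) → G) = a := by
  ext j
  simp [relTuple]

lemma relTuple_eq_relTuple_iff (i : Fin (n + 1)) (x y : Fin (n + 1) → G) :
    relTuple i x = relTuple i y ↔ ∀ j k, x j / x k = y j / y k := by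
  constructor
  · intro h
    have hi : ∀ j, x j / x i = y j / y i := by
      rw [Fin.forall_iff_succAbove i]
      exact ⟨by simp, fun j => congrFun h j⟩
    intro j k
    rw [← div_div_div_cancel_right (x j) (x k) (x i), hi j, hi k, div_div_div_cancel_right]
  · intro h
    ext j
    exact h _ _

lemma eq_cfg_iff (h : Fin n → G) (g : G) (x : Fin (n + 1) → G) :
    x = cfg h g ↔ g = x 0 ∧ relTuple 0 x = h := by
  simp only [funext_iff, cfg, relTuple, Fin.forall_fin_succ, Fin.cons_zero, Fin.cons_succ,
    Fin.succAbove_zero, div_eq_iff_eq_mul]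
  constructor
  · rintro ⟨rfl, h⟩
    exact ⟨rfl, h⟩
  · rintro ⟨rfl, h⟩
    exact ⟨rfl, h⟩

variable [DecidableEq G]

variable (G) in
/-- The isometry `|a⟩ ↦ |e⟩_i ⊗ |a⟩`. -/
def insIsometry (i : Fin (n + 1)) : Matrix (Fin (n + 1) → G) (Fin n → G) ℂ :=
  Matrix.of fun x a => if x = i.insertNth 1 a then 1 else 0

lemma insIsometry_apply (i : Fin (n + 1)) (x : Fin (n + 1) → G) (a : Fin n → G) :
    insIsometry G i x a = if x i = 1 then (if a = i.removeNth x then 1 else 0) else 0 := by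
  simp only [insIsometry, Matrix.of_apply, Fin.eq_insertNth_iff, ite_and, eq_comm]

variable [Fintype G]

lemma card_filter_relTuple_eq (i : Fin (n + 1)) (a : Fin n → G) :
    (Finset.univ.filter fun x : Fin (n + 1) → G => relTuple i x = a).card =
      Fintype.card G := by
  refine Finset.card_bij' (fun x _ => x i)
    (fun g _ => (i.insertNth g fun j => a j * g : Fin (n + 1) → G)) ?_ ?_ ?_ ?_
  · simp
  · intro g _
    simp only [Finset.mem_filter, Finset.mem_univ, true_and]
    ext j
    simp [relTuple]
  · intro x hx
    simp only [Finset.mem_filter, Finset.mem_univ, true_and] at hx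
    subst hx
    rw [Fin.insertNth_eq_iff]
    exact ⟨rfl, funext fun j => by simp [relTuple, Fin.removeNth]⟩
  · simp

variable (G) in
/-- The isometry `|a⟩ ↦ |G|^{-1/2} ∑ |x⟩`, the sum running over the configurations `x`
whose relations seen from particle `i` are `a`. -/
def relIsometry (i : Fin (n + 1)) : Matrix (Fin (n + 1) → G) (Fin n → G) ℂ :=
  Matrix.of fun x a => if relTuple i x = a then relNorm G else 0

lemma relKet_one_apply (h : Fin n → G) (x : Fin (n + 1) → G) :
    relKet h (1 : Ghat G) x = relIsometry G 0 x h := by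
  have hχ : ∀ g : G, (1 : Ghat G).1 g = 1 := fun _ => rfl
  simp only [relKet, hχ, one_smul, Pi.smul_apply, Finset.sum_apply, ket, eq_cfg_iff, ite_and,
    Finset.sum_ite_eq', Finset.mem_univ, if_true, smul_eq_mul, mul_ite, mul_one, mul_zero,
    relIsometry, Matrix.of_apply, relNorm]

lemma relIsometry_mul_conjTranspose_apply (i : Fin (n + 1)) (x y : Fin (n + 1) → G) :
    (relIsometry G i * (relIsometry G i)ᴴ) x y =
      if relTuple i x = relTuple i y then relNorm G * relNorm G else 0 := by
  by_cases h : relTuple i x = relTuple i y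
  · simp [Matrix.mul_apply, relIsometry, h, apply_ite, star_relNorm, -RCLike.star_def]
  · simp [Matrix.mul_apply, relIsometry, h, apply_ite, star_relNorm, -RCLike.star_def]

lemma Piphys_eq (i : Fin (n + 1)) :
    Piphys G n = relIsometry G i * (relIsometry G i)ᴴ := by
  ext x y
  have hsum : Piphys G n x y =
      (relIsometry G (0 : Fin (n + 1)) * (relIsometry G (0 : Fin (n + 1)))ᴴ) x y := by
    rw [Matrix.mul_apply]
    simp [Piphys, Matrix.sum_apply, outer, relKet_one_apply]
  rw [hsum, relIsometry_mul_conjTranspose_apply, relIsometry_mul_conjTranspose_apply]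
  simp only [relTuple_eq_relTuple_iff]

lemma conjTranspose_relIsometry_mul_self (i : Fin (n + 1)) :
    (relIsometry G i)ᴴ * relIsometry G i = 1 := by
  ext a b
  have hterm : ∀ x : Fin (n + 1) → G, star (relIsometry G i x a) * relIsometry G i x b =
      if relTuple i x = a then (if a = b then relNorm G * relNorm G else 0) else 0 := by
    intro x
    by_cases hx : relTuple i x = a
    · simp [relIsometry, hx, star_relNorm, -RCLike.star_def]
    · simp [relIsometry, hx]
  simp only [Matrix.mul_apply, Matrix.conjTranspose_apply, hterm]
  rw [← Finset.sum_filter, Finset.sum_const, card_filter_relTuple_eq, nsmul_eq_mul, mul_ite,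
    card_mul_relNorm_sq, mul_zero, Matrix.one_apply]

lemma conjTranspose_relIsometry_mul_insIsometry (i : Fin (n + 1)) :
    (relIsometry G i)ᴴ * insIsometry G i =
      relNorm G • 1 := by
  ext a b
  by_cases h : b = a
  · simp [Matrix.mul_apply, relIsometry, insIsometry, relTuple_insertNth_one, h]
    exact star_relNorm G
  · simp [Matrix.mul_apply, relIsometry, insIsometry, relTuple_insertNth_one, h, Ne.symm h]

lemma eAop_eq (i : Fin (n + 1)) (A : Matrix (Fin n → G) (Fin n → G) ℂ) :
    eAop i A = insIsometry G i * A * (insIsometry G i)ᴴ := by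
  ext x y
  by_cases hx : x i = 1 <;> by_cases hy : y i = 1 <;>
    simp [eAop, Matrix.mul_apply, insIsometry_apply, hx, hy, apply_ite]
  rfl

lemma Fmap_eq (i : Fin (n + 1)) (A : Matrix (Fin n → G) (Fin n → G) ℂ) :
    Fmap G i A = relIsometry G i * A * (relIsometry G i)ᴴ := by
  have hW := conjTranspose_relIsometry_mul_insIsometry (G := G) i
  have hW' : (insIsometry G i)ᴴ * relIsometry G i =
      relNorm G • 1 := by
    simpa [star_relNorm, -RCLike.star_def] using congrArg conjTranspose hW
  calc Fmap G i A = (Fintype.card G : ℂ) • (relIsometry G i *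
        (((relIsometry G i)ᴴ * insIsometry G i) * A * ((insIsometry G i)ᴴ * relIsometry G i)) *
          (relIsometry G i)ᴴ) := by
        simp only [Fmap, Piphys_eq i, eAop_eq, Matrix.mul_assoc]
    _ = ((Fintype.card G : ℂ) * (relNorm G * relNorm G)) •
        (relIsometry G i * A * (relIsometry G i)ᴴ) := by
        simp [hW, hW', smul_smul]
    _ = relIsometry G i * A * (relIsometry G i)ᴴ := by
        rw [card_mul_relNorm_sq, one_smul]

end RelationalIsometry

/-- The map `A ↦ F_A = |G| ⬝ Π_phys (|e⟩⟨e|_i ⊗ A) Π_phys` is a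
bijection of `L(ℂ^{G^{N-1}})` onto `A_phys` preserving linear combinations, products
and adjoints, i.e. a star-algebra isomorphism onto `A_phys`. -/
theorem stmt11 (G : Type) [Fintype G] [DecidableEq G] [CommGroup G] (n : ℕ)
    (i : Fin (n + 1)) :
    (∀ (A B : Matrix (Fin n → G) (Fin n → G) ℂ) (lam mu : ℂ),
      Fmap G i (lam • A + mu • B) = lam • Fmap G i A + mu • Fmap G i B) ∧
    (∀ A B : Matrix (Fin n → G) (Fin n → G) ℂ,
      Fmap G i (A * B) = Fmap G i A * Fmap G i B) ∧
    (∀ A : Matrix (Fin n → G) (Fin n → G) ℂ, Fmap G i Aᴴ = (Fmap G i A)ᴴ) ∧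
    Function.Injective (Fmap G i) ∧
    Set.range (Fmap G i) = Aphys G n := by
  have hW := conjTranspose_relIsometry_mul_self (G := G) i
  have hcomp : ∀ A : Matrix (Fin n → G) (Fin n → G) ℂ,
      (relIsometry G i)ᴴ * Fmap G i A * relIsometry G i = A := by
    intro A
    calc (relIsometry G i)ᴴ * Fmap G i A * relIsometry G i
        = ((relIsometry G i)ᴴ * relIsometry G i) * A * ((relIsometry G i)ᴴ * relIsometry G i) := by
          simp only [Fmap_eq, Matrix.mul_assoc]
      _ = A := by rw [hW, Matrix.one_mul, Matrix.mul_one]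
  have hproj : ∀ X : Op G (n + 1), Piphys G n * X * Piphys G n =
      Fmap G i ((relIsometry G i)ᴴ * X * relIsometry G i) := by
    intro X
    simp only [Piphys_eq i, Fmap_eq, Matrix.mul_assoc]
  refine ⟨?_, ?_, ?_, ?_, ?_⟩
  · intro A B lam mu
    simp only [Fmap_eq, Matrix.mul_add, Matrix.add_mul, Matrix.mul_smul, Matrix.smul_mul]
  · intro A B
    calc Fmap G i (A * B)
        = relIsometry G i * A * ((relIsometry G i)ᴴ * relIsometry G i) * B * (relIsometry G i)ᴴ := by
          rw [hW, Matrix.mul_one, Fmap_eq, Matrix.mul_assoc _ A B]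
      _ = Fmap G i A * Fmap G i B := by
          simp only [Fmap_eq, Matrix.mul_assoc]
  · intro A
    simp only [Fmap_eq, Matrix.conjTranspose_mul, Matrix.conjTranspose_conjTranspose,
      Matrix.mul_assoc]
  · exact Function.LeftInverse.injective
      (g := fun X => (relIsometry G i)ᴴ * X * relIsometry G i) hcomp
  · ext X
    constructor
    · rintro ⟨A, rfl⟩
      change _ = _
      rw [hproj, hcomp]
    · intro hX
      exact ⟨_, (hproj X).symm.trans (Eq.symm hX)⟩

end QRF

end
end
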